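/- arXiv:1810.12143 — 2 statements merged into one kernel-verified Lean document; each statement's English description precedes it below -/
import Mathlib

section
/- Fix z₀ ∈ ℂ \ {0} and set ζ₀ = −conj z₀. Suppose for z ∈ {z₀, ζ₀} there are matrices Φ₊(x,t;z), Φ₋(x,t;z) ∈ Matrix (Fin 2) (Fin 2) ℂ satisfying the symmetries Φ₊(x,t;z) = σ₄ · conj(Φ₋(−x,−t;−conj z)) · σ₄ and Φ₋(x,t;z) = σ₄ · conj(Φ₊(−x,−t;−conj z)) · σ₄ for all (x,t). Suppose further that there are constants b[z₀], b[ζ₀] ∈ ℂ and some (x,t) at which the column Φ₋₂(x,t;z₀) is nonzero, such that Φ₊₁(x,t;z₀) = b[z₀] · Φ₋₂(x,t;z₀) and Φ₊₁(x,t;ζ₀) = b[ζ₀] · Φ₋₂(x,t;ζ₀) hold for all (x,t). Then b[z₀] · conj(b[ζ₀]) = −σ. In particular, if z₀ is purely imaginary (so ζ₀ = z₀), then |b[z₀]|² = −σ, which forces σ = −1; hence for σ = 1 no purely imaginary discrete eigenvalue with such a nonzero proportionality constant can exist. -/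
def pauli1 : Matrix (Fin 2) (Fin 2) ℂ := !![0, 1; 1, 0]

def pauli2 : Matrix (Fin 2) (Fin 2) ℂ := !![0, -Complex.I; Complex.I, 0]

/-- Symmetry of the norming constants from the first symmetry of the Jost solutions:
`b[z₀] conj(b[ζ₀]) = −σ` with `ζ₀ = −z̄₀`; in particular for purely imaginary `z₀`
one gets `|b[z₀]|² = −σ`, which forces `σ = −1`, so for `σ = 1` there is no purely
imaginary discrete eigenvalue with such a nonzero proportionality constant. -/
theorem b_symmetry_first
    (σ : ℝ) (hσ : σ = 1 ∨ σ = -1)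
    (σ4 : Matrix (Fin 2) (Fin 2) ℂ)
    (hσ4 : (σ = -1 ∧ σ4 = pauli1) ∨ (σ = 1 ∧ σ4 = pauli2))
    (z₀ : ℂ) (hz₀ : z₀ ≠ 0)
    (Φp Φm : ℝ → ℝ → ℂ → Matrix (Fin 2) (Fin 2) ℂ)
    (hsym1 : ∀ (x t : ℝ), ∀ z ∈ ({z₀, -(starRingEnd ℂ z₀)} : Set ℂ),
      Φp x t z = σ4 * (Φm (-x) (-t) (-(starRingEnd ℂ z))).map (starRingEnd ℂ) * σ4)
    (hsym2 : ∀ (x t : ℝ), ∀ z ∈ ({z₀, -(starRingEnd ℂ z₀)} : Set ℂ),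
      Φm x t z = σ4 * (Φp (-x) (-t) (-(starRingEnd ℂ z))).map (starRingEnd ℂ) * σ4)
    (b0 bζ : ℂ)
    (hnz : ∃ (x t : ℝ) (i : Fin 2), Φm x t z₀ i 1 ≠ 0)
    (hb0 : ∀ (x t : ℝ) (i : Fin 2), Φp x t z₀ i 0 = b0 * Φm x t z₀ i 1)
    (hbζ : ∀ (x t : ℝ) (i : Fin 2),
      Φp x t (-(starRingEnd ℂ z₀)) i 0 = bζ * Φm x t (-(starRingEnd ℂ z₀)) i 1) :
    b0 * starRingEnd ℂ bζ = -(σ : ℂ)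
    ∧ (z₀.re = 0 → ((‖b0‖ : ℝ) : ℂ) ^ 2 = -(σ : ℂ) ∧ σ = -1)
    ∧ (σ = 1 → z₀.re ≠ 0) := by
  obtain ⟨x, t, i, hi⟩ := hnz
  have h1 := hsym1 x t z₀ (by simp)
  have h2 := hsym2 x t z₀ (by simp)
  have hz := hbζ (-x) (-t)
  have h0 := hb0 x t i
  have key : Φm x t z₀ i 1 = -(σ : ℂ) * starRingEnd ℂ bζ * Φp x t z₀ i 0 := by
    have hz0 := hz 0
    have hz1 := hz 1
    rw [h1, h2]
    rcases hσ4 with ⟨rfl, rfl⟩ | ⟨rfl, rfl⟩ <;> fin_cases i <;>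
      simp [pauli1, pauli2, Matrix.mul_apply, Matrix.vecMul, dotProduct, Fin.sum_univ_two, hz0, hz1] <;>
      ring_nf
  have hσ2 : (σ : ℂ) * σ = 1 := by
    rcases hσ with rfl | rfl <;> simp
  have main : b0 * starRingEnd ℂ bζ = -(σ : ℂ) := by
    rw [h0] at key
    apply mul_right_cancel₀ hi
    linear_combination (σ : ℂ) * key - b0 * starRingEnd ℂ bζ * Φm x t z₀ i 1 * hσ2
  have second : z₀.re = 0 → ((‖b0‖ : ℝ) : ℂ) ^ 2 = -(σ : ℂ) ∧ σ = -1 := by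
    intro hre
    have hzz : -(starRingEnd ℂ z₀) = z₀ := by
      apply Complex.ext <;> simp [hre]
    have hbb : bζ = b0 := by
      have h3 := hbζ x t i
      rw [hzz, h0] at h3
      exact (mul_right_cancel₀ hi h3).symm
    rw [hbb, Complex.mul_conj'] at main
    refine ⟨main, ?_⟩
    have hr : ‖b0‖ ^ 2 = -σ := by exact_mod_cast main
    rcases hσ with h | h
    · nlinarith [sq_nonneg ‖b0‖]
    · exact h
  refine ⟨main, second, ?_⟩
  intro h hre
  have := (second hre).2
  linarith
end

section
/- Let N₁, N₂ ∈ ℕ, let z₁, …, z_{N₁} ∈ ℂ \ {0}, and let w₁, …, w_{N₂} be nonzero reals. Define η_n = z_n for 1 ≤ n ≤ N₁, η_{N₁+n} = −conj(z_n) for 1 ≤ n ≤ N₁, and η_{2N₁+m} = i w_m for 1 ≤ m ≤ N₂; set η̂_n = δσ q₀²/η_n for each n. Then the rational function z ↦ ∏_{n=1}^{2N₁+N₂} (z − η_n)/(z − η̂_n) tends, as z → 0, to (∏_{n=1}^{N₁} |z_n|⁴/q₀⁴) · (∏_{m=1}^{N₂} (−δσ) w_m²/q₀²). -/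
theorem theta_factor_tendsto (c η : ℂ) (hc : c ≠ 0) (hη : η ≠ 0) :
    Filter.Tendsto (fun z : ℂ => (z - η) / (z - c / η)) (nhdsWithin 0 {0}ᶜ)
      (nhds (η ^ 2 / c)) := by
  have h : ContinuousAt (fun z : ℂ => (z - η) / (z - c / η)) 0 := by
    apply ContinuousAt.div
    · fun_prop
    · fun_prop
    · simp [hc, hη]
  have h2 := h.tendsto.mono_left (nhdsWithin_le_nhds (s := {0}ᶜ))
  have e : (0 - η) / (0 - c / η) = η ^ 2 / c := by
    rw [zero_sub, zero_sub, neg_div_neg_eq]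
    field_simp
  rwa [e] at h2

/-- The limit, as `z → 0`, of the product `∏ₙ (z − ηₙ)/(z − η̂ₙ)` over the discrete
spectrum `{zₙ, −z̄ₙ}ₙ ∪ {i wₘ}ₘ`, with `η̂ = δσq₀²/η`, equals
`(∏ₙ |zₙ|⁴/q₀⁴) ∏ₘ (−δσ) wₘ²/q₀²` — the computation underlying the theta condition. -/
theorem theta_condition_limit
    (q₀ δ σ : ℝ) (hq₀ : 0 < q₀) (hδ : δ = 1 ∨ δ = -1) (hσ : σ = 1 ∨ σ = -1)
    (N₁ N₂ : ℕ) (zs : Fin N₁ → ℂ) (hzs : ∀ n, zs n ≠ 0)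
    (w : Fin N₂ → ℝ) (hw : ∀ m, w m ≠ 0) :
    Filter.Tendsto
      (fun z : ℂ =>
        (∏ n, (z - zs n) / (z - (δ : ℂ) * (σ : ℂ) * (q₀ : ℂ) ^ 2 / zs n)) *
        (∏ n, (z - (-(starRingEnd ℂ (zs n)))) /
          (z - (δ : ℂ) * (σ : ℂ) * (q₀ : ℂ) ^ 2 / (-(starRingEnd ℂ (zs n))))) *
        (∏ m, (z - Complex.I * (w m : ℂ)) /
          (z - (δ : ℂ) * (σ : ℂ) * (q₀ : ℂ) ^ 2 / (Complex.I * (w m : ℂ)))))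
      (nhdsWithin 0 {0}ᶜ)
      (nhds (((∏ n, ‖zs n‖ ^ 4 / q₀ ^ 4 : ℝ) : ℂ) *
             ((∏ m, -(δ * σ) * w m ^ 2 / q₀ ^ 2 : ℝ) : ℂ))) := by
  have hs : ((δ : ℂ) * (σ : ℂ)) ^ 2 = 1 := by
    rcases hδ with rfl | rfl <;> rcases hσ with rfl | rfl <;> norm_num
  have hs0 : (δ : ℂ) * (σ : ℂ) ≠ 0 := by
    intro h
    rw [h] at hs
    norm_num at hs
  have hq : (q₀ : ℂ) ≠ 0 := by exact_mod_cast hq₀.ne'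
  have hc : (δ : ℂ) * (σ : ℂ) * (q₀ : ℂ) ^ 2 ≠ 0 := mul_ne_zero hs0 (pow_ne_zero 2 hq)
  have hbar : ∀ n, -(starRingEnd ℂ (zs n)) ≠ 0 := fun n => by simp [hzs n]
  have hI : ∀ m, Complex.I * (w m : ℂ) ≠ 0 := fun m => by simp [hw m]
  have key := ((tendsto_finsetProd Finset.univ
      (fun n _ => theta_factor_tendsto _ (zs n) hc (hzs n))).mul
    (tendsto_finsetProd Finset.univ
      (fun n _ => theta_factor_tendsto _ _ hc (hbar n)))).mul
    (tendsto_finsetProd Finset.univ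
      (fun m _ => theta_factor_tendsto _ _ hc (hI m)))
  convert key using 2
  rw [← Finset.prod_mul_distrib]
  push_cast
  congr 1
  · refine Finset.prod_congr rfl fun n _ => ?_
    have hn : (‖zs n‖ : ℂ) ^ 4 = (zs n) ^ 2 * (starRingEnd ℂ (zs n)) ^ 2 := by
      rw [← mul_pow, Complex.mul_conj']
      ring
    rw [hn, div_mul_div_comm, neg_sq]
    congr 1
    linear_combination (-(q₀ : ℂ) ^ 4) * hs
  · refine Finset.prod_congr rfl fun m _ => ?_
    rw [mul_pow, Complex.I_sq, div_eq_div_iff (pow_ne_zero 2 hq) hc]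
    linear_combination (-(w m : ℂ) ^ 2 * (q₀ : ℂ) ^ 2) * hs
end
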